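/- If S : ℝ³ → ℝ^{3×3} is a smooth matrix field with S(x)^⊤ = S(x) for all x, then the matrix field RotRot^⊤ S is also pointwise symmetric: (RotRot^⊤ S)(x)^⊤ = (RotRot^⊤ S)(x) for all x. -/

import Mathlib

open Matrix

noncomputable section

/-- Points of `ℝ³`. -/
abbrev V3 := Fin 3 → ℝ
/-- Real `3×3` matrices. -/
abbrev M3 := Matrix (Fin 3) (Fin 3) ℝ

/-- Partial derivative `∂ᵢ f` of a scalar function on `ℝ³`. -/
def pd (i : Fin 3) (f : V3 → ℝ) (x : V3) : ℝ := fderiv ℝ f x (Pi.single i 1)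

/-- Gradient of a scalar function. -/
def grad (f : V3 → ℝ) (x : V3) : V3 := fun i => pd i f x

/-- Divergence of a vector field. -/
def vdiv (v : V3 → V3) (x : V3) : ℝ := ∑ i, pd i (fun y => v y i) x

/-- Curl (rotation) of a vector field. -/
def vrot (v : V3 → V3) (x : V3) : V3 :=
  ![pd 1 (fun y => v y 2) x - pd 2 (fun y => v y 1) x,
    pd 2 (fun y => v y 0) x - pd 0 (fun y => v y 2) x,
    pd 0 (fun y => v y 1) x - pd 1 (fun y => v y 0) x]

/-- Jacobian matrix `(Grad v)_{ij} = ∂_j v_i` of a vector field. -/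
def vGrad (v : V3 → V3) (x : V3) : M3 := Matrix.of fun i j => pd j (fun y => v y i) x

/-- Row-wise curl of a matrix field. -/
def mRot (S : V3 → M3) (x : V3) : M3 := Matrix.of fun i => vrot (fun y => S y i) x

/-- Row-wise divergence of a matrix field. -/
def mDiv (S : V3 → M3) (x : V3) : V3 := fun i => vdiv (fun y => S y i) x

/-- The second order operator `RotRot^⊤ S = Rot ((Rot S)ᵀ)`. -/
def rotRotT (S : V3 → M3) (x : V3) : M3 := mRot (fun y => (mRot S y)ᵀ) x

/-- Symmetric part of a matrix. -/
def msym (M : M3) : M3 := (2⁻¹ : ℝ) • (M + Mᵀ)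

/-- Skew-symmetric part of a matrix. -/
def mskw (M : M3) : M3 := (2⁻¹ : ℝ) • (M - Mᵀ)

/-- Deviatoric (trace-free) part of a matrix. -/
def mdev (M : M3) : M3 := M - (Matrix.trace M / 3) • (1 : M3)

/-- The skew-symmetric matrix `spn w` with `(spn w) x = w × x`. -/
def spn (w : V3) : M3 := !![0, -w 2, w 1; w 2, 0, -w 0; -w 1, w 0, 0]

/-- The axial vector of a (skew-symmetric) matrix; inverse of `spn`. -/
def spnInv (M : M3) : V3 := ![M 2 1, M 0 2, M 1 0]

end

/-- Partial derivatives of a `C²` function are differentiable. -/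
theorem differentiableAt_pd {f : V3 → ℝ} (hf : ContDiff ℝ 2 f) (i : Fin 3) (x : V3) :
    DifferentiableAt ℝ (pd i f) x :=
  (((hf.fderiv_right (m := 1) (by norm_num)).clm_apply contDiff_const).differentiable
    (by norm_num)).differentiableAt

theorem pd_sub {f g : V3 → ℝ} {x : V3} (i : Fin 3) (hf : DifferentiableAt ℝ f x)
    (hg : DifferentiableAt ℝ g x) : pd i (fun y => f y - g y) x = pd i f x - pd i g x := by
  simp only [pd, fderiv_fun_sub hf hg, _root_.sub_apply]

theorem pd_pd_eq_fderiv_fderiv {f : V3 → ℝ} (hf : ContDiff ℝ 2 f) (i j : Fin 3) (x : V3) :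
    pd i (pd j f) x = fderiv ℝ (fderiv ℝ f) x (Pi.single i 1) (Pi.single j 1) := by
  have hd : DifferentiableAt ℝ (fderiv ℝ f) x :=
    ((hf.fderiv_right (m := 1) (by norm_num)).differentiable (by norm_num)).differentiableAt
  have h := fderiv_clm_apply hd (differentiableAt_const (c := (Pi.single j 1 : V3)))
  change fderiv ℝ (fun y => fderiv ℝ f y (Pi.single j 1)) x (Pi.single i 1) = _
  rw [h]
  simp

/-- Schwarz's theorem for the partial derivatives `pd`. -/
theorem pd_comm {f : V3 → ℝ} (hf : ContDiff ℝ 2 f) (i j : Fin 3) (x : V3) :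
    pd i (pd j f) x = pd j (pd i f) x := by
  rw [pd_pd_eq_fderiv_fderiv hf, pd_pd_eq_fderiv_fderiv hf]
  exact (hf.contDiffAt.isSymmSndFDerivAt (by simp)).eq _ _

/-- `RotRot^⊤` preserves pointwise symmetry. -/
theorem rotRotT_symmetric (S : V3 → M3)
    (hS : ∀ i j, ContDiff ℝ (⊤ : ℕ∞) fun y => S y i j)
    (hsym : ∀ x, (S x)ᵀ = S x) :
    ∀ x, (rotRotT S x)ᵀ = rotRotT S x := by
  intro x
  have hC (i j : Fin 3) : ContDiff ℝ 2 fun y => S y i j := contDiff_infty.1 (hS i j) 2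
  have hsub (k a b i j i' j' : Fin 3) :
      pd k (fun y => pd a (fun z => S z i j) y - pd b (fun z => S z i' j') y) x =
        pd k (pd a fun z => S z i j) x - pd k (pd b fun z => S z i' j') x :=
    pd_sub k (differentiableAt_pd (hC i j) a x) (differentiableAt_pd (hC i' j') b x)
  have hs (i j : Fin 3) : (fun y => S y i j) = fun y => S y j i :=
    funext fun y => congrFun (congrFun (hsym y) j) i
  have h10 := hs 1 0
  have h20 := hs 2 0
  have h21 := hs 2 1
  have c10 (i j : Fin 3) := pd_comm (hC i j) 1 0 x
  have c20 (i j : Fin 3) := pd_comm (hC i j) 2 0 x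
  have c21 (i j : Fin 3) := pd_comm (hC i j) 2 1 x
  ext i j
  fin_cases i <;> fin_cases j <;>
    simp [rotRotT, mRot, vrot, hsub, h10, h20, h21, c10, c20, c21] <;> ring
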